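/- Let M be a nonzero uniformly finite R-module, N a submodule with N ≠ M, and N = N₁ ∩ ⋯ ∩ N_s a shortest primary decomposition of N in M with As_R(M/N_i) = {X_i} for each i. Then the left primes X₁, ..., X_s are pairwise distinct and every associated left prime of M/N equals X_i for exactly one index i; in particular As_R(M/N) = {X₁, ..., X_s}. -/

import Mathlib

/-!
Definitions following Bavula, "Primary decompositions for left Noetherian rings".
All modules are left modules over an associative ring `R` with 1.
-/

universe u v

section Defs

variable (R : Type u) [Ring R]

/-- `N` is an essential submodule of the module `A`:
it intersects every nonzero submodule of `A` nontrivially. -/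
def EssentialSub {A : Type v} [AddCommGroup A] [Module R A] (N : Submodule R A) : Prop :=
  ∀ L : Submodule R A, L ≠ ⊥ → N ⊓ L ≠ ⊥

/-- A module `A` is uniform: it is nonzero and every nonzero submodule is essential. -/
def UniformMod (A : Type v) [AddCommGroup A] [Module R A] : Prop :=
  Nontrivial A ∧ ∀ V : Submodule R A, V ≠ ⊥ → EssentialSub R V

/-- A submodule is uniform if it is uniform as a module. -/
def UniformSub {A : Type v} [AddCommGroup A] [Module R A] (U : Submodule R A) : Prop :=
  UniformMod R ↥U

/-- `A` has finite uniform dimension: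
it contains no infinite direct sum of nonzero submodules. -/
def FinUdim (A : Type v) [AddCommGroup A] [Module R A] : Prop :=
  ¬ ∃ f : ℕ → Submodule R A, (∀ n, f n ≠ ⊥) ∧ iSupIndep f

/-- `A` has uniform dimension `n`: there is an essential direct sum of `n`
uniform submodules of `A`. -/
def UdimEq (A : Type v) [AddCommGroup A] [Module R A] (n : ℕ) : Prop :=
  ∃ U : Fin n → Submodule R A, (∀ i, UniformSub R (U i)) ∧
    iSupIndep U ∧ EssentialSub R (⨆ i, U i)

/-- Essential equivalence of modules: they possess isomorphic essential submodules. -/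
def EssEquiv (A B : ModuleCat.{v} R) : Prop :=
  ∃ (L₁ : Submodule R A) (L₂ : Submodule R B),
    EssentialSub R L₁ ∧ EssentialSub R L₂ ∧ Nonempty (L₁ ≃ₗ[R] L₂)

/-- The left spectrum-style quotient: classes `[A]` of modules under essential
equivalence (for uniform modules these classes are the left primes). -/
def LeftSpec := Quot (EssEquiv R)

/-- The class `[A]` of the module `A` under essential equivalence. -/
def leftPrime (A : Type v) [AddCommGroup A] [Module R A] : LeftSpec.{u, v} R :=
  Quot.mk _ (ModuleCat.of R A)

/-- The set `As_R(A)` of associated left primes of `A`: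
the classes of the uniform submodules of `A`. -/
def leftAss (A : Type v) [AddCommGroup A] [Module R A] : Set (LeftSpec.{u, v} R) :=
  { x | ∃ U : Submodule R A, UniformSub R U ∧ x = leftPrime R ↥U }

/-- `A` is uniformly finite: every factor module of `A` has finite uniform dimension. -/
def UniformlyFinite (A : Type v) [AddCommGroup A] [Module R A] : Prop :=
  ∀ N : Submodule R A, FinUdim R (A ⧸ N)

/-- `N` is an `X`-primary submodule of `A`: `A/N` has finite uniform dimension and
`As_R(A/N) = {X}`. -/
def PrimarySub {A : Type v} [AddCommGroup A] [Module R A] (N : Submodule R A)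
    (X : LeftSpec.{u, v} R) : Prop :=
  FinUdim R (A ⧸ N) ∧ leftAss R (A ⧸ N) = {X}

/-- `Ns` is a primary decomposition of `N` in `A`. -/
def IsPrimaryDecomp {A : Type v} [AddCommGroup A] [Module R A] (N : Submodule R A)
    (s : ℕ) (Ns : Fin s → Submodule R A) : Prop :=
  N = ⨅ i, Ns i ∧ ∀ i, ∃ X, PrimarySub R (Ns i) X

/-- `Ns` is a shortest primary decomposition of `N` in `A`:
no primary decomposition of `N` in `A` has fewer terms. -/
def IsShortestPrimaryDecomp {A : Type v} [AddCommGroup A] [Module R A] (N : Submodule R A)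
    (s : ℕ) (Ns : Fin s → Submodule R A) : Prop :=
  IsPrimaryDecomp R N s Ns ∧
    ∀ (t : ℕ) (Ls : Fin t → Submodule R A), IsPrimaryDecomp R N t Ls → s ≤ t

/-- `C` is a complement to `W` in the ambient module: `W ⊓ C = ⊥` and `C` is maximal
with this property. -/
def IsComplementTo {A : Type v} [AddCommGroup A] [Module R A] (C W : Submodule R A) : Prop :=
  W ⊓ C = ⊥ ∧ ∀ D : Submodule R A, C ≤ D → W ⊓ D = ⊥ → D = C

/-- A proper submodule `N ⊊ A` is irreducible if it is not the intersection of two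
strictly larger submodules. -/
def IrreducibleSub {A : Type v} [AddCommGroup A] [Module R A] (N : Submodule R A) : Prop :=
  N ≠ ⊤ ∧ ¬ ∃ P Q : Submodule R A, N < P ∧ N < Q ∧ N = P ⊓ Q

/-- The multiplicity of the left prime `x` in `A` is `m`: in some (equivalently, any)
essential direct sum of uniform submodules of `A`, exactly `m` summands lie in class `x`. -/
def HasMult (A : Type v) [AddCommGroup A] [Module R A] (x : LeftSpec.{u, v} R) (m : ℕ) : Prop :=
  ∃ (n : ℕ) (U : Fin n → Submodule R A), (∀ i, UniformSub R (U i)) ∧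
    iSupIndep U ∧ EssentialSub R (⨆ i, U i) ∧
    m = Nat.card {i : Fin n // leftPrime R ↥(U i) = x}

end Defs

section Uniform

variable {R : Type u} [Ring R] {A B : Type v} [AddCommGroup A] [Module R A]
  [AddCommGroup B] [Module R B]

/-- Uniformity is invariant under isomorphism. -/
theorem UniformMod.of_linearEquiv (e : A ≃ₗ[R] B) (hA : UniformMod R A) : UniformMod R B := by
  have := hA.1
  refine ⟨e.symm.toEquiv.nontrivial, fun V hV L hL h => ?_⟩
  have key : ∀ W : Submodule R B, W ≠ ⊥ → W.comap e.toLinearMap ≠ ⊥ := by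
    intro W hW h0
    apply hW
    rw [← Submodule.map_comap_eq_of_surjective (f := e.toLinearMap) e.surjective W, h0,
      Submodule.map_bot]
  refine hA.2 _ (key V hV) _ (key L hL) ?_
  rw [← Submodule.comap_inf, h, Submodule.comap_bot]
  exact LinearMap.ker_eq_bot.2 e.injective

/-- Isomorphic modules have the same essential-equivalence class. -/
theorem leftPrime_eq_of_linearEquiv (e : A ≃ₗ[R] B) : leftPrime R A = leftPrime R B := by
  apply Quot.sound
  refine ⟨⊤, ⊤, ?_, ?_, ⟨(Submodule.topEquiv.trans e).trans Submodule.topEquiv.symm⟩⟩ <;>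
  · intro L hL
    rwa [top_inf_eq]

/-- The class of a uniform module embedded in `A` is an associated left prime of `A`. -/
theorem leftPrime_mem_leftAss (hB : UniformMod R B) (f : B →ₗ[R] A)
    (hf : Function.Injective f) : leftPrime R B ∈ leftAss R A :=
  ⟨f.range, hB.of_linearEquiv (LinearEquiv.ofInjective f hf),
    leftPrime_eq_of_linearEquiv (LinearEquiv.ofInjective f hf)⟩

/-- A nonzero submodule in which any two nonzero submodules meet nontrivially is uniform. -/
theorem uniformSub_of_forall_le {U : Submodule R A} (hU : U ≠ ⊥)
    (h : ∀ P ≤ U, P ≠ ⊥ → ∀ Q ≤ U, Q ≠ ⊥ → P ⊓ Q ≠ ⊥) : UniformSub R U := by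
  refine ⟨(Submodule.nontrivial_iff_ne_bot).2 hU, fun V hV L hL hVL => ?_⟩
  have key : ∀ W : Submodule R U, W ≠ ⊥ → W.map U.subtype ≠ ⊥ := fun W hW h0 =>
    hW (Submodule.map_injective_of_injective U.injective_subtype
      (h0.trans (Submodule.map_bot _).symm))
  refine h _ (Submodule.map_subtype_le U V) (key V hV) _ (Submodule.map_subtype_le U L)
    (key L hL) ?_
  rw [← Submodule.map_inf _ U.injective_subtype, hVL, Submodule.map_bot]

/-- If each term of a sequence of submodules is disjoint from a submodule containing all later
terms, then the sequence is independent. -/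
theorem iSupIndep_of_antitone_disjoint {P W : ℕ → Submodule R A} (hW : Antitone W)
    (hP : ∀ n, P n ≤ W n) (hd : ∀ n, Disjoint (P n) (W (n + 1))) : iSupIndep P := by
  rw [iSupIndep_iff_finsetSum_eq_zero_imp_eq_zero]
  intro s v hv hsum i
  induction i using Nat.strong_induction_on with
  | _ i ih =>
    intro hi
    refine Submodule.disjoint_def.1 (hd i) _ (hv i hi) ?_
    rw [← s.add_sum_erase _ hi, add_eq_zero_iff_eq_neg] at hsum
    rw [hsum]
    refine neg_mem (sum_mem fun j hj => ?_)
    obtain ⟨hji, hj⟩ := Finset.mem_erase.1 hj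
    rcases lt_or_gt_of_ne hji with hlt | hlt
    · rw [ih j hlt hj]
      exact zero_mem _
    · exact hW hlt (hP j (hv j hj))

/-- In a module of finite uniform dimension every nonzero submodule contains a uniform one. -/
theorem FinUdim.exists_uniformSub_le (hA : FinUdim R A) {V : Submodule R A} (hV : V ≠ ⊥) :
    ∃ U ≤ V, UniformSub R U := by
  by_contra! hno
  have split : ∀ W : {W : Submodule R A // W ≤ V ∧ W ≠ ⊥},
      ∃ (P : Submodule R A) (Q : {W : Submodule R A // W ≤ V ∧ W ≠ ⊥}),
        P ≤ W.1 ∧ P ≠ ⊥ ∧ Q.1 ≤ W.1 ∧ Disjoint P Q.1 := by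
    rintro ⟨W, hWV, hW⟩
    by_contra! hcon
    refine hno W hWV (uniformSub_of_forall_le hW fun P hP hP0 Q hQ hQ0 hPQ => ?_)
    exact hcon P ⟨Q, hQ.trans hWV, hQ0⟩ hP hP0 hQ (disjoint_iff.2 hPQ)
  choose P Q hP hP0 hQ hd using split
  let W : ℕ → {W : Submodule R A // W ≤ V ∧ W ≠ ⊥} := fun n => Q^[n] ⟨V, le_rfl, hV⟩
  have hW : ∀ n, W (n + 1) = Q (W n) := fun n => Function.iterate_succ_apply' Q n _
  refine hA ⟨fun n => P (W n), fun n => hP0 _, iSupIndep_of_antitone_disjoint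
    (W := fun n => (W n).1) (antitone_nat_of_succ_le fun n => ?_) (fun n => hP _) fun n => ?_⟩
  · rw [hW]
    exact hQ _
  · rw [hW]
    exact hd _

/-- In a uniform module a finite family of nonzero submodules has nonzero intersection. -/
theorem UniformMod.exists_eq_bot_of_iInf_eq_bot (hA : UniformMod R A) {ι : Type*} [Finite ι]
    {K : ι → Submodule R A} (h : ⨅ i, K i = ⊥) : ∃ i, K i = ⊥ := by
  have := Fintype.ofFinite ι
  have := hA.1
  by_contra! hK
  have key : ∀ s : Finset ι, s.inf K ≠ ⊥ := fun s =>
    Finset.inf_induction top_ne_bot (fun V hV L hL => hA.2 V hV L hL) fun i _ => hK i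
  exact key Finset.univ (by rwa [Finset.inf_univ_eq_iInf])

/-- The associated left primes of the quotient by a finite intersection are among those of the
quotients by its terms. -/
theorem exists_mem_leftAss_of_mem_leftAss_quotient_iInf {ι : Type*} [Finite ι]
    {Ns : ι → Submodule R A} {x : LeftSpec.{u, v} R} (hx : x ∈ leftAss R (A ⧸ ⨅ i, Ns i)) :
    ∃ i, x ∈ leftAss R (A ⧸ Ns i) := by
  obtain ⟨U, hU, rfl⟩ := hx
  let f : ∀ i, U →ₗ[R] A ⧸ Ns i := fun i =>
    (Submodule.factor (iInf_le Ns i)).domRestrict U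
  have hker : ⨅ i, (f i).ker = ⊥ := by
    rw [eq_bot_iff]
    rintro ⟨u, hu⟩ h
    obtain ⟨a, rfl⟩ := Submodule.mkQ_surjective _ u
    rw [Submodule.mem_bot, Subtype.ext_iff]
    refine (Submodule.Quotient.mk_eq_zero _).2 ((Submodule.mem_iInf _).2 fun i => ?_)
    exact (Submodule.Quotient.mk_eq_zero _).1 (LinearMap.mem_ker.1 ((Submodule.mem_iInf _).1 h i))
  obtain ⟨i, hi⟩ := UniformMod.exists_eq_bot_of_iInf_eq_bot hU hker
  exact ⟨i, leftPrime_mem_leftAss hU (f i) (LinearMap.ker_eq_bot.1 hi)⟩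

/-- If `K ⊓ L ≤ N ≤ L` and `K` is not contained in `N`, then `A ⧸ N` and `A ⧸ L` share an
associated left prime, provided `A ⧸ N` has finite uniform dimension. -/
theorem exists_mem_leftAss_quotient_inter {N K L : Submodule R A} (hfin : FinUdim R (A ⧸ N))
    (hNL : N ≤ L) (hKL : K ⊓ L ≤ N) (hKN : ¬ K ≤ N) :
    ∃ x ∈ leftAss R (A ⧸ N), x ∈ leftAss R (A ⧸ L) := by
  have hK : K.map N.mkQ ≠ ⊥ := by
    rwa [Ne, ← LinearMap.le_ker_iff_map, Submodule.ker_mkQ]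
  obtain ⟨U, hUK, hU⟩ := hfin.exists_uniformSub_le hK
  refine ⟨_, ⟨U, hU, rfl⟩, leftPrime_mem_leftAss hU ((Submodule.factor hNL).domRestrict U) ?_⟩
  rw [← LinearMap.ker_eq_bot, eq_bot_iff]
  rintro ⟨u, hu⟩ h
  obtain ⟨k, hk, rfl⟩ := hUK hu
  rw [Submodule.mem_bot, Subtype.ext_iff]
  refine (Submodule.Quotient.mk_eq_zero _).2 (hKL ⟨hk, ?_⟩)
  exact (Submodule.Quotient.mk_eq_zero _).1 (LinearMap.mem_ker.1 h)

/-- If `A ⧸ N` is nonzero of finite uniform dimension, then it has an associated left prime. -/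
theorem leftAss_quotient_nonempty {N : Submodule R A} (hfin : FinUdim R (A ⧸ N))
    (hN : N ≠ ⊤) : (leftAss R (A ⧸ N)).Nonempty := by
  have := Submodule.Quotient.nontrivial_iff.2 hN
  obtain ⟨U, -, hU⟩ := hfin.exists_uniformSub_le top_ne_bot
  exact ⟨_, U, hU, rfl⟩

/-- A primary submodule is proper. -/
theorem PrimarySub.ne_top {N : Submodule R A} {X : LeftSpec.{u, v} R} (h : PrimarySub R N X) :
    N ≠ ⊤ := by
  rintro rfl
  obtain ⟨U, hU, -⟩ : X ∈ leftAss R (A ⧸ (⊤ : Submodule R A)) := h.2 ▸ rfl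
  have := hU.1
  exact not_subsingleton U inferInstance

/-- In a uniformly finite module the intersection of two `X`-primary submodules is
`X`-primary. -/
theorem PrimarySub.inf (hA : UniformlyFinite R A) {P Q : Submodule R A} {X : LeftSpec.{u, v} R}
    (hP : PrimarySub R P X) (hQ : PrimarySub R Q X) : PrimarySub R (P ⊓ Q) X := by
  refine ⟨hA _, Set.Nonempty.subset_singleton_iff ?_ |>.1 fun x hx => ?_⟩
  · exact leftAss_quotient_nonempty (hA _) (ne_top_of_le_ne_top hP.ne_top inf_le_left)
  · rw [inf_eq_iInf] at hx
    obtain ⟨i, hi⟩ := exists_mem_leftAss_of_mem_leftAss_quotient_iInf hx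
    cases i
    · exact hQ.2 ▸ hi
    · exact hP.2 ▸ hi

end Uniform

/-- Theorem `RlufAss`(3): if `N = N₁ ∩ ⋯ ∩ N_s` is a shortest
primary decomposition of a proper submodule `N` of a nonzero uniformly finite module
`M`, with `As_R(M/Nᵢ) = {Xᵢ}`, then the `Xᵢ` are pairwise distinct, and every
associated left prime of `M/N` equals `Xᵢ` for exactly one index `i`; in particular
`As_R(M/N) = {X₁, …, X_s}`. -/
theorem distinct_primes_of_shortest_primaryDecomposition
    {R : Type u} [Ring R] {M : Type v} [AddCommGroup M] [Module R M]
    (hM : Nontrivial M) (huf : UniformlyFinite R M)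
    (N : Submodule R M) (hN : N ≠ ⊤)
    (s : ℕ) (Ns : Fin s → Submodule R M) (X : Fin s → LeftSpec.{u, v} R)
    (hprim : ∀ i, PrimarySub R (Ns i) (X i))
    (hshort : IsShortestPrimaryDecomp R N s Ns) :
    Function.Injective X ∧
      (∀ x ∈ leftAss R (M ⧸ N), ∃! i, X i = x) ∧
      leftAss R (M ⧸ N) = Set.range X := by
  have hNs : N = ⨅ i, Ns i := hshort.1.1
  have hinj : Function.Injective X := by
    intro i j hij
    by_contra hne
    obtain _ | t := s
    · exact i.elim0
    obtain ⟨k, rfl⟩ := Fin.exists_succAbove_eq (Ne.symm hne)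
    refine absurd (hshort.2 t
      (Function.update (fun l => Ns (i.succAbove l)) k (Ns i ⊓ Ns (i.succAbove k)))
      ⟨le_antisymm (le_iInf fun l => ?_) ?_, fun l => ?_⟩) (by omega)
    · rw [hNs]
      rcases eq_or_ne l k with rfl | hl
      · rw [Function.update_self]
        exact le_inf (iInf_le _ _) (iInf_le _ _)
      · rw [Function.update_of_ne hl]
        exact iInf_le _ _
    · rw [hNs]
      refine le_iInf ((Fin.forall_iff_succAbove i).2 ⟨?_, fun l => ?_⟩)
      · refine (iInf_le _ k).trans ?_
        rw [Function.update_self]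
        exact inf_le_left
      · refine (iInf_le _ l).trans ?_
        rcases eq_or_ne l k with rfl | hl
        · rw [Function.update_self]
          exact inf_le_right
        · rw [Function.update_of_ne hl]
    · rcases eq_or_ne l k with rfl | hl
      · rw [Function.update_self]
        exact ⟨X i, (hprim i).inf huf (hij ▸ hprim _)⟩
      · rw [Function.update_of_ne hl]
        exact ⟨_, hprim _⟩
  have hmem : ∀ x ∈ leftAss R (M ⧸ N), ∃ i, X i = x := by
    intro x hx
    rw [hNs] at hx
    obtain ⟨i, hi⟩ := exists_mem_leftAss_of_mem_leftAss_quotient_iInf hx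
    rw [(hprim i).2] at hi
    exact ⟨i, hi.symm⟩
  refine ⟨hinj, fun x hx => ?_, Set.Subset.antisymm hmem ?_⟩
  · obtain ⟨i, rfl⟩ := hmem x hx
    exact ⟨i, rfl, fun j hj => hinj hj⟩
  · rintro _ ⟨i, rfl⟩
    obtain _ | t := s
    · exact i.elim0
    have hle : (⨅ l, Ns (i.succAbove l)) ⊓ Ns i ≤ N := hNs ▸
      le_iInf ((Fin.forall_iff_succAbove i).2
        ⟨inf_le_right, fun l => inf_le_left.trans (iInf_le _ l)⟩)
    have hnle : ¬ ⨅ l, Ns (i.succAbove l) ≤ N := fun h =>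
      absurd (hshort.2 t (fun l => Ns (i.succAbove l))
        ⟨le_antisymm (le_iInf fun l => hNs ▸ iInf_le _ _) h, fun l => ⟨_, hprim _⟩⟩) (by omega)
    obtain ⟨x, hxN, hxi⟩ :=
      exists_mem_leftAss_quotient_inter (huf N) (hNs ▸ iInf_le _ i) hle hnle
    rw [(hprim i).2] at hxi
    rwa [← Set.mem_singleton_iff.1 hxi]
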